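/- arXiv:2103.11605 — 2 statements merged into one kernel-verified Lean document; each statement's English description precedes it below -/
import Mathlib

section
/- Let p ≥ 2, c ≥ 1 be integers and b = pc − 1. Let 0 = s_0 < s_1 < ⋯ < s_{k−1} < s_k = n. Then the probability that the set of d′-descents of the (b,n,p)-shuffle equals {s_1,…,s_{k−1},n} is P′(s_1,…,s_{k−1},n) = b^{−n} · det( f′(i,j) )_{i,j = 0,…,k−1}, where f′(i,j) = binom(s_{j+1} − s_i + b − 1, b − 1) for 0 ≤ i ≤ k−1 and 0 ≤ j ≤ k−2, and f′(i,k−1) = binom(n − s_i + b − 1, b − 1) − binom(n − s_i + b − c, b − c) for 0 ≤ i ≤ k−1. -/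
open scoped Classical

noncomputable section

/-- Binomial coefficient with integer top, taken to be `0` when the top is negative
(so in particular `zchoose a r = 0` whenever `a < r`). -/
def zchoose (a : ℤ) (r : ℕ) : ℕ := if 0 ≤ a then a.toNat.choose r else 0

/-- Rank of a color `r ∈ Z_p` in the order `0, p-1, p-2, …, 1` used to define
the linear order on `Σ = {1,…,n} × Z_p`. -/
def rho (p : ℕ) (r : ZMod p) : ℕ := if r = 0 then 0 else p - r.val

/-- The linear order on `Σ`: `(i,r) < (j,s)` iff the color of `r` comes strictly earlier
(in the order `0, p-1, …, 1`), or the colors agree and `i < j`. -/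
def sigmaLt (p : ℕ) (x y : ℕ × ZMod p) : Prop :=
  rho p x.2 < rho p y.2 ∨ (rho p x.2 = rho p y.2 ∧ x.1 < y.1)

/-- The position part of the `(b,n,p)`-shuffle determined by labels `A`:
`σ(i) = #{j : A j < A i, or A j = A i and j ≤ i}`. -/
def shufflePos {n b : ℕ} (A : Fin n → Fin b) (i : Fin n) : ℕ :=
  (Finset.univ.filter fun j : Fin n => A j < A i ∨ (A j = A i ∧ j ≤ i)).card

/-- The color part of the `(b,n,p)`-shuffle determined by labels `A`: `σ_c(i) = A i mod p`. -/
def shuffleCol (p : ℕ) {n b : ℕ} (A : Fin n → Fin b) (i : Fin n) : ZMod p :=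
  ((A i : ℕ) : ZMod p)

/-- The pair `(σ(i), σ_c(i))` of the `(b,n,p)`-shuffle determined by labels `A`. -/
def shufflePair (p : ℕ) {n b : ℕ} (A : Fin n → Fin b) (i : Fin n) : ℕ × ZMod p :=
  (shufflePos A i, shuffleCol p A i)

/-- The shuffle `π[A]` has a d-descent at position `i+1` (positions are `1,…,n`):
for positions `< n` this means `(σ(i),σ_c(i)) > (σ(i+1),σ_c(i+1))`,
and at position `n` it means `σ_c(n) ≠ 0`. -/
def shuffleHasDDescentAt (p : ℕ) {n b : ℕ} (A : Fin n → Fin b) (i : Fin n) : Prop :=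
  if h : (i : ℕ) + 1 < n then
    sigmaLt p (shufflePair p A ⟨(i : ℕ) + 1, h⟩) (shufflePair p A i)
  else shuffleCol p A i ≠ 0

/-- The set of d-descent positions (a subset of `{1,…,n}`) of the shuffle `π[A]`. -/
def shuffleDDescentSet (p : ℕ) {n b : ℕ} (A : Fin n → Fin b) : Finset ℕ :=
  (Finset.univ.filter fun i : Fin n => shuffleHasDDescentAt p A i).image fun i => (i : ℕ) + 1


/-- The dash order on `Σ`: `(i,r) <′ (j,s)` iff `r < s` (colors in the order `0,1,…,p-1`),
or `r = s` and `i < j`. -/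
def sigmaLt' {p : ℕ} (x y : ℕ × ZMod p) : Prop :=
  x.2.val < y.2.val ∨ (x.2 = y.2 ∧ x.1 < y.1)

/-- The shuffle `π[A]` has a d′-descent at position `i+1` (positions are `1,…,n`):
for positions `< n` this means `(σ(i),σ_c(i)) >′ (σ(i+1),σ_c(i+1))`,
and at position `n` it means `σ_c(n) = p - 1`. -/
def shuffleHasD'DescentAt (p : ℕ) {n b : ℕ} (A : Fin n → Fin b) (i : Fin n) : Prop :=
  if h : (i : ℕ) + 1 < n then
    sigmaLt' (shufflePair p A ⟨(i : ℕ) + 1, h⟩) (shufflePair p A i)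
  else shuffleCol p A i = ((p - 1 : ℕ) : ZMod p)

/-- The set of d′-descent positions (a subset of `{1,…,n}`) of the shuffle `π[A]`. -/
def shuffleD'DescentSet (p : ℕ) {n b : ℕ} (A : Fin n → Fin b) : Finset ℕ :=
  (Finset.univ.filter fun i : Fin n => shuffleHasD'DescentAt p A i).image fun i => (i : ℕ) + 1

def Wd (b a e : ℕ) : Set (ℕ → ℕ) :=
  {x | (∀ t, a ≤ t → t < e → x t < b) ∧ ∀ t, ¬ (a ≤ t ∧ t < e) → x t = 0}

def WInc (a e : ℕ) (x : ℕ → ℕ) : Prop := ∀ t, a < t → t < e → x (t - 1) ≤ x t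

lemma Wd_finite (b a e : ℕ) : (Wd b a e).Finite := by
  refine Set.Finite.of_injOn (f := fun x => fun i : Fin e => (x i : ℕ))
    (t := Set.pi Set.univ (fun _ => Set.Iio (b+1))) ?_ ?_ (Set.Finite.pi fun _ => Set.finite_Iio _)
  · intro x hx i _
    have h1 := hx.1 i
    have h2 := hx.2 i
    have := i.2
    simp only [Set.mem_Iio]
    by_cases h : a ≤ (i : ℕ)
    · have := h1 h i.2; omega
    · have := h2 (by omega); omega
  · intro x hx y hy hxy
    funext t
    by_cases h : t < e
    · exact congrFun hxy ⟨t, h⟩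
    · rw [hx.2 t (by omega), hy.2 t (by omega)]

lemma ncard_add (b a e : ℕ) (P P1 P2 : (ℕ → ℕ) → Prop)
    (h : ∀ x ∈ Wd b a e, (P x ↔ P1 x ∨ P2 x)) (hd : ∀ x ∈ Wd b a e, P1 x → ¬ P2 x) :
    {x | x ∈ Wd b a e ∧ P x}.ncard =
      {x | x ∈ Wd b a e ∧ P1 x}.ncard + {x | x ∈ Wd b a e ∧ P2 x}.ncard := by
  rw [← Set.ncard_union_eq ?_ ((Wd_finite b a e).subset fun x hx => hx.1)
    ((Wd_finite b a e).subset fun x hx => hx.1)]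
  · congr 1
    ext x
    simp only [Set.mem_ofPred_eq, Set.mem_union]
    have := h x
    tauto
  · rw [Set.disjoint_left]
    rintro x ⟨h1, h2⟩ ⟨_, h3⟩
    exact hd x h1 h2 h3

lemma ncard_split (b a d e : ℕ) (had : a ≤ d) (hde : d ≤ e) (P Q : (ℕ → ℕ) → Prop)
    (hP : ∀ x y : ℕ → ℕ, (∀ t, a ≤ t → t < d → x t = y t) → P x → P y)
    (hQ : ∀ x y : ℕ → ℕ, (∀ t, d ≤ t → t < e → x t = y t) → Q x → Q y) :
    {x | x ∈ Wd b a e ∧ P x ∧ Q x}.ncard =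
      {x | x ∈ Wd b a d ∧ P x}.ncard * {x | x ∈ Wd b d e ∧ Q x}.ncard := by
  rw [← Set.ncard_prod]
  refine Set.ncard_congr (fun x _ => (fun t => if t < d then x t else 0,
    fun t => if d ≤ t then x t else 0)) ?_ ?_ ?_
  · rintro x ⟨⟨h1, h2⟩, hp, hq⟩
    refine ⟨⟨⟨?_, ?_⟩, ?_⟩, ⟨⟨?_, ?_⟩, ?_⟩⟩
    · intro t h h'; simp only [if_pos h']; exact h1 t h (by omega)
    · intro t h; simp only
      split_ifs with h'
      · exact h2 t (by omega)
      · rfl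
    · exact hP x _ (fun t h h' => by simp [h']) hp
    · intro t h h'; simp only [if_pos h]; exact h1 t (by omega) h'
    · intro t h; simp only
      split_ifs with h'
      · exact h2 t (by omega)
      · rfl
    · exact hQ x _ (fun t h h' => by simp [h]) hq
  · intro x y hx hy hxy
    funext t
    have e1 := congrFun (congrArg Prod.fst hxy) t
    have e2 := congrFun (congrArg Prod.snd hxy) t
    simp only at e1 e2
    by_cases h : t < d
    · simpa [h] using e1
    · simpa [not_lt.1 h] using e2
  · rintro ⟨y, z⟩ ⟨⟨⟨hy1, hy2⟩, hp⟩, ⟨⟨hz1, hz2⟩, hq⟩⟩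
    simp only at hy1 hy2 hz1 hz2 hp hq
    refine ⟨fun t => if t < d then y t else z t, ⟨⟨?_, ?_⟩, ?_, ?_⟩, ?_⟩
    · intro t h h'; simp only
      split_ifs with g
      · exact hy1 t h g
      · exact hz1 t (by omega) h'
    · intro t h; simp only
      split_ifs with g
      · exact hy2 t (by omega)
      · exact hz2 t (by omega)
    · exact hP y _ (fun t h h' => by simp [h']) hp
    · exact hQ z _ (fun t h h' => by simp [not_lt.2 h]) hq
    · refine Prod.ext ?_ ?_
      · funext t; simp only
        split_ifs with g
        · rfl
        · exact (hy2 t (by omega)).symm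
      · funext t; simp only
        split_ifs with g g'
        · omega
        · rfl
        · exact (hz2 t (by omega)).symm

lemma WInc_le {a e : ℕ} {x : ℕ → ℕ} (h : WInc a e x) {t u : ℕ} (hat : a ≤ t) (htu : t ≤ u)
    (hu : u < e) : x t ≤ x u := by
  induction u, htu using Nat.le_induction with
  | base => exact le_rfl
  | succ u hu' ih =>
    have := h (u+1) (by omega) hu
    simp only [Nat.add_sub_cancel] at this
    exact (ih (by omega)).trans this

lemma inc_last (m b a l : ℕ) (hm : m ≤ b) :
    {x | x ∈ Wd b a (a + (l + 1)) ∧ (WInc a (a + (l + 1)) x ∧ x (a + l) < m)} =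
      {x | x ∈ Wd m a (a + (l + 1)) ∧ WInc a (a + (l + 1)) x} := by
  ext x
  simp only [Set.mem_ofPred_eq]
  constructor
  · rintro ⟨h, h1, h2⟩
    refine ⟨⟨fun t ht ht' => ?_, h.2⟩, h1⟩
    have := WInc_le h1 ht (show t ≤ a + l by omega) (by omega)
    omega
  · rintro ⟨h, h1⟩
    exact ⟨⟨fun t ht ht' => (h.1 t ht ht').trans_le hm, h.2⟩, h1, h.1 _ (by omega) (by omega)⟩

lemma ncard_inc (a : ℕ) : ∀ l b : ℕ,
    {x | x ∈ Wd b a (a + l) ∧ WInc a (a + l) x}.ncard = Nat.multichoose b l := by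
  intro l
  induction l with
  | zero =>
    intro b
    rw [Nat.multichoose_zero_right, Set.ncard_eq_one]
    refine ⟨fun _ => 0, ?_⟩
    ext x
    simp only [Set.mem_ofPred_eq, Set.mem_singleton_iff]
    constructor
    · rintro ⟨h, _⟩; funext t; exact h.2 t (by omega)
    · rintro rfl; exact ⟨⟨fun t _ _ => by omega, fun _ _ => rfl⟩, fun _ _ _ => le_rfl⟩
  | succ l ihl =>
    intro b
    induction b with
    | zero =>
      rw [Nat.multichoose_zero_succ]
      convert Set.ncard_empty (ℕ → ℕ)
      ext x
      simp only [Set.mem_ofPred_eq, Set.mem_empty_iff_false, iff_false]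
      rintro ⟨h, _⟩
      have := h.1 a le_rfl (by omega)
      omega
    | succ b ihb =>
      rw [Nat.multichoose_succ_succ, ← ihb, ← ihl (b+1), ← inc_last b (b+1) a l (by omega)]
      rw [ncard_add (b+1) a (a + (l+1)) (WInc a (a + (l+1)))
        (fun x => WInc a (a + (l+1)) x ∧ x (a+l) < b)
        (fun x => WInc a (a + (l+1)) x ∧ x (a+l) = b)
        (fun x hx => by have := hx.1 (a+l) (by omega) (by omega); grind)
        (fun x hx => by grind)]
      refine congrArg₂ _ rfl ?_
      refine Set.ncard_congr (fun x _ => Function.update x (a+l) 0) ?_ ?_ ?_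
      · rintro x ⟨⟨h1, h2⟩, h3, h4⟩
        refine ⟨⟨?_, ?_⟩, ?_⟩
        · intro t ht ht'
          simp only [Function.update_apply]
          split_ifs
          · omega
          · exact h1 t ht (by omega)
        · intro t ht
          simp only [Function.update_apply]
          split_ifs
          · rfl
          · exact h2 t (by omega)
        · intro t ht ht'
          simp only [Function.update_apply]
          rw [if_neg (by omega), if_neg (by omega)]
          exact h3 t ht (by omega)
      · rintro x y ⟨_, _, hx⟩ ⟨_, _, hy⟩ hxy
        funext t
        have := congrFun hxy t
        simp only [Function.update_apply] at this
        split_ifs at this with h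
        · rw [h, hx, hy]
        · exact this
      · rintro y ⟨⟨h1, h2⟩, h3⟩
        refine ⟨Function.update y (a+l) b, ⟨⟨?_, ?_⟩, ?_, ?_⟩, ?_⟩
        · intro t ht ht'
          simp only [Function.update_apply]
          split_ifs
          · omega
          · exact h1 t ht (by omega)
        · intro t ht
          simp only [Function.update_apply]
          rw [if_neg (by omega)]
          exact h2 t (by omega)
        · intro t ht ht'
          simp only [Function.update_apply]
          rw [if_neg (by omega)]
          split_ifs with h
          · have := h1 (t-1) (by omega) (by omega); omega
          · exact h3 t ht (by omega)
        · simp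
        · have := h2 (a+l) (by omega)
          simp [← this]

def WEx (D : ℕ → Prop) (m a n : ℕ) (x : ℕ → ℕ) : Prop :=
  (∀ t, a < t → t < n → (x t < x (t - 1) ↔ D t)) ∧ m ≤ x (n - 1)

/-- the intermediate sets -/
def WW (D : ℕ → Prop) (m b n a d : ℕ) : ℕ :=
  {x | x ∈ Wd b a n ∧ (WInc a d x ∧ (∀ t, d ≤ t → t < n → (x t < x (t - 1) ↔ D t)) ∧
    m ≤ x (n - 1))}.ncard

def WE (D : ℕ → Prop) (m b n a : ℕ) : ℕ := {x | x ∈ Wd b a n ∧ WEx D m a n x}.ncard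

lemma WE_eq (D : ℕ → Prop) (m b n a d : ℕ) (had : a < d)
    (hD : ∀ t, a < t → t < d → ¬ D t) (hdn : d ≤ n) : WE D m b n a = WW D m b n a d := by
  unfold WE WW
  congr 1
  ext x
  simp only [Set.mem_ofPred_eq, WEx, WInc]
  constructor
  · rintro ⟨h, h1, h2⟩
    refine ⟨h, ?_, fun t ht ht' => h1 t (by omega) ht', h2⟩
    intro t ht ht'
    have := h1 t ht (by omega)
    have := hD t ht ht'
    grind
  · rintro ⟨h, h0, h1, h2⟩
    refine ⟨h, ?_, h2⟩
    intro t ht ht'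
    by_cases g : t < d
    · have := hD t ht g
      have := h0 t ht g
      grind
    · exact h1 t (by omega) ht'

lemma WW_step (D : ℕ → Prop) (m b n a d d' : ℕ) (had : a < d) (hdd : d < d') (hdn : d' ≤ n)
    (hDd : D d) (hD : ∀ t, d < t → t < d' → ¬ D t) :
    Nat.multichoose b (d - a) * WE D m b n d = WW D m b n a d + WW D m b n a d' := by
  have h1 := ncard_inc a (d - a) b
  rw [show a + (d - a) = d by omega] at h1
  rw [← h1, WE, ← ncard_split b a d n had.le (by omega)]
  · unfold WW
    apply ncard_add
    · intro x hx
      simp only [WEx, WInc]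
      constructor
      · rintro ⟨h0, h1, h2⟩
        by_cases g : x d < x (d - 1)
        · left
          refine ⟨h0, ?_, h2⟩
          intro t ht ht'
          rcases ht.eq_or_lt with rfl | h
          · simp [g, hDd]
          · exact h1 t h ht'
        · right
          refine ⟨?_, fun t ht ht' => h1 t (by omega) ht', h2⟩
          intro t ht ht'
          rcases lt_trichotomy t d with h | rfl | h
          · exact h0 t ht h
          · omega
          · have := hD t h ht'
            have := h1 t h (by omega)
            grind
      · rintro (⟨h0, h1, h2⟩ | ⟨h0, h1, h2⟩)
        · exact ⟨h0, fun t ht ht' => h1 t (by omega) ht', h2⟩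
        · refine ⟨fun t ht ht' => h0 t ht (by omega), ?_, h2⟩
          intro t ht ht'
          by_cases g : t < d'
          · have := hD t ht g
            have := h0 t (by omega) g
            grind
          · exact h1 t (by omega) ht'
    · rintro x hx ⟨h0, h1, h2⟩ ⟨h3, h4, h5⟩
      have e1 := (h1 d le_rfl (by omega)).2 hDd
      have e2 := h3 d had hdd
      omega
  · intro x y hxy h t ht ht'
    rw [← hxy t (by omega) ht', ← hxy (t-1) (by omega) (by omega)]
    exact h t ht ht'
  · rintro x y hxy ⟨h, h'⟩
    refine ⟨fun t ht ht' => ?_, ?_⟩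
    · rw [← hxy t (by omega) ht', ← hxy (t-1) (by omega) (by omega)]
      exact h t ht ht'
    · rwa [← hxy (n-1) (by omega) (by omega)]

lemma WW_last (D : ℕ → Prop) (m b n a : ℕ) (han : a < n) (hm : m ≤ b) :
    Nat.multichoose b (n - a) = Nat.multichoose m (n - a) + WW D m b n a n := by
  obtain ⟨l, rfl⟩ : ∃ l, n = a + (l + 1) := ⟨n - a - 1, by omega⟩
  rw [show a + (l+1) - a = l + 1 by omega, ← ncard_inc a (l+1) b, ← ncard_inc a (l+1) m,
    ← inc_last m b a l hm]
  unfold WW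
  apply ncard_add
  · intro x hx
    rw [show a + (l+1) - 1 = a + l by omega]
    constructor
    · intro h
      by_cases g : x (a+l) < m
      · exact Or.inl ⟨h, g⟩
      · exact Or.inr ⟨h, fun t _ _ => by omega, by omega⟩
    · rintro (h | h) <;> exact h.1
  · rintro x hx ⟨h, h'⟩ ⟨_, _, h2⟩
    rw [show a + (l+1) - 1 = a + l by omega] at h2
    omega

lemma zchoose_multi (b l : ℕ) (hb : 1 ≤ b) (z : ℤ) (hz : z = l) :
    zchoose (z + b - 1) (b - 1) = Nat.multichoose b l := by
  subst hz
  rw [zchoose, if_pos (by omega), Nat.multichoose_eq,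
    show ((l : ℤ) + b - 1).toNat = b + l - 1 by omega]
  exact Nat.choose_symm_of_eq_add (by omega)

lemma zchoose_neg (b : ℕ) (hb : 1 ≤ b) (z : ℤ) (hz : z < 0) :
    zchoose (z + b - 1) (b - 1) = 0 := by
  rw [zchoose]
  split_ifs
  · exact Nat.choose_eq_zero_of_lt (by omega)
  · rfl

lemma det_hess (K : ℕ) (M : Matrix (Fin (K+1)) (Fin (K+1)) ℝ) (w : ℕ → ℕ → ℝ)
    (h0 : ∀ i j : Fin (K+1), (j : ℕ) < K → (j : ℕ) + 1 < i → M i j = 0)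
    (h1 : ∀ i j : Fin (K+1), (j : ℕ) < K → (j : ℕ) + 1 = i → M i j = 1)
    (h2 : ∀ i j : Fin (K+1), (j : ℕ) < K → i ≤ j →
      M i j * w (j + 1) (j + 2) = w i (j + 1) + w i (j + 2))
    (h3 : ∀ i : Fin (K+1), M i (Fin.last K) = w i (K + 1)) :
    M.det = w 0 1 := by
  let v : Fin (K+1) → ℝ := fun j => if (j : ℕ) < K then (-1)^((j:ℕ)+1) * w (j+1) (j+2)
    else (-1)^(K+1)
  have hv : M.mulVec v = fun i => if i = 0 then - w 0 1 else 0 := by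
    funext i
    let T : ℕ → ℝ := fun j => if (i : ℕ) ≤ j then (-1)^j * w i (j+1) else 0
    have hT : ∀ j : Fin K, M i j.castSucc * v j.castSucc = T (j+1) - T j := by
      intro j
      have hj : ((j.castSucc : Fin (K+1)) : ℕ) < K := by simp
      simp only [v, if_pos hj, T]
      rcases lt_trichotomy ((j : ℕ) + 1) (i : ℕ) with h | h | h
      · rw [h0 i _ hj (by simpa using h), if_neg (by omega), if_neg (by omega)]; simp
      · rw [h1 i _ hj (by simpa using h), if_pos (by omega), if_neg (by omega)]
        simp [← h]
      · have := h2 i j.castSucc hj (by rw [Fin.le_def]; simp; omega)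
        rw [if_pos (by omega), if_pos (by omega)]
        simp only [Fin.val_castSucc] at this ⊢
        rw [mul_left_comm, this]
        ring
    simp only [Matrix.mulVec, dotProduct]
    rw [Fin.sum_univ_castSucc, Finset.sum_congr rfl (fun j _ => hT j), h3,
      Fin.sum_univ_eq_sum_range (fun j => T (j+1) - T j), Finset.sum_range_sub]
    have hi : (i : ℕ) ≤ K := by omega
    simp only [v, T, Fin.val_last, lt_irrefl, if_false, if_pos hi]
    by_cases h : i = 0
    · subst h; simp; ring
    · have : ¬ (i : ℕ) ≤ 0 := by
        intro h'; apply h; ext; simpa using h'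
      simp only [if_neg this, if_neg h]
      ring
  have hadj : M.adjugate (Fin.last K) 0 = (-1)^K := by
    rw [Matrix.adjugate_fin_succ_eq_det_submatrix, Matrix.det_of_isUpperTriangular]
    · rw [Finset.prod_eq_one]
      · simp
      · intro i _
        simp only [Matrix.submatrix_apply, Fin.succAbove_zero, Fin.succAbove_last]
        exact h1 _ _ (by simp) (by simp)
    · intro i j hij
      simp only [Matrix.submatrix_apply, Fin.succAbove_zero, Fin.succAbove_last]
      have hij' : (j : ℕ) < i := hij
      exact h0 _ _ (by simp) (by simp only [Fin.val_castSucc, Fin.val_succ]; omega)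
  have := congrFun (congrArg (M.adjugate.mulVec) hv) (Fin.last K)
  rw [Matrix.mulVec_mulVec, Matrix.adjugate_mul, Matrix.smul_mulVec, Matrix.one_mulVec] at this
  simp only [Matrix.mulVec, dotProduct, Pi.smul_apply, smul_eq_mul, mul_ite, mul_zero,
    Finset.sum_ite_eq', Finset.mem_univ, if_true, hadj, v, Fin.val_last, lt_irrefl, if_false] at this
  have hne : ((-1:ℝ))^K ≠ 0 := by simp
  rw [pow_succ] at this
  apply mul_left_cancel₀ hne
  linarith

lemma phi_lt (p c a a' : ℕ) (hp : 0 < p) (ha : a < p * c) (ha' : a' < p * c) :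
    a % p * c + a / p < a' % p * c + a' / p ↔ (a % p < a' % p ∨ (a % p = a' % p ∧ a < a')) := by
  have h1 : a / p < c := Nat.div_lt_of_lt_mul ha
  have h2 : a' / p < c := Nat.div_lt_of_lt_mul ha'
  have e1 := Nat.div_add_mod a p
  have e2 := Nat.div_add_mod a' p
  generalize a / p = q at *
  generalize a' / p = q' at *
  generalize a % p = r at *
  generalize a' % p = r' at *
  rcases lt_trichotomy r r' with h | h | h
  · have : (r + 1) * c ≤ r' * c := Nat.mul_le_mul_right _ h
    simp only [h, true_or, iff_true]
    nlinarith
  · subst h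
    simp only [lt_irrefl, true_and, false_or, add_lt_add_iff_left]
    rw [← e1, ← e2]
    simp only [add_lt_add_iff_right]
    exact (Nat.mul_lt_mul_left hp).symm
  · have : (r' + 1) * c ≤ r * c := Nat.mul_le_mul_right _ h
    constructor
    · intro; nlinarith
    · rintro (h | h) <;> omega

lemma phi_bound (p c b a : ℕ) (hp : 2 ≤ p) (hb : b + 1 = p * c) (ha : a < b) :
    a % p * c + a / p < b := by
  have hc : 0 < c := by rcases Nat.eq_zero_or_pos c with rfl | h; · omega
                        · exact h
  have := (phi_lt p c a b (by omega) (by omega) (by omega)).2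
  have hbm : b = (c-1) * p + (p - 1) := by
    obtain ⟨c, rfl⟩ : ∃ d, c = d + 1 := ⟨c-1, by omega⟩
    obtain ⟨p, rfl⟩ : ∃ d, p = d + 1 := ⟨p-1, by omega⟩
    simp only [Nat.add_sub_cancel]
    nlinarith
  have hb1 : b % p = p - 1 := by
    rw [hbm, add_comm, Nat.add_mul_mod_self_right, Nat.mod_eq_of_lt (by omega)]
  have hb2 : b / p = c - 1 := by
    rw [hbm, mul_comm, Nat.mul_add_div (by omega), Nat.div_eq_of_lt (a := p-1) (by omega)]; rfl
  have h3 : a % p < p := Nat.mod_lt _ (by omega)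
  have h4 := this (by omega)
  have : b % p * c + b / p = b := by
    rw [hb1, hb2]
    obtain ⟨c, rfl⟩ : ∃ d, c = d + 1 := ⟨c-1, by omega⟩
    obtain ⟨p, rfl⟩ : ∃ d, p = d + 1 := ⟨p-1, by omega⟩
    simp only [Nat.add_sub_cancel] at *
    nlinarith
  omega

lemma phi_inv (p c y : ℕ) (hc : 0 < c) (hp : 0 < p) (hy : y < p * c) :
    ((y % c * p + y / c) % p) * c + (y % c * p + y / c) / p = y := by
  have h1 : y / c < p := Nat.div_lt_of_lt_mul (by rwa [mul_comm])
  have e : (y % c * p + y / c) % p = y / c := by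
    rw [add_comm, Nat.add_mul_mod_self_right, Nat.mod_eq_of_lt h1]
  have e' : (y % c * p + y / c) / p = y % c := by
    rw [add_comm, Nat.add_mul_div_right _ _ hp, Nat.div_eq_of_lt h1, zero_add]
  rw [e, e', mul_comm]
  exact Nat.div_add_mod y c

lemma pos_lt {n b : ℕ} (A : Fin n → Fin b) (i i' : Fin n) (hi : i < i') :
    shufflePos A i' < shufflePos A i ↔ A i' < A i := by
  constructor
  · intro h
    by_contra hh
    push Not at hh
    refine absurd h (not_lt.2 (Finset.card_le_card ?_))
    intro j
    simp only [Finset.mem_filter, Finset.mem_univ, true_and]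
    rintro (h | ⟨h, h'⟩)
    · exact Or.inl (h.trans_le hh)
    · rw [h]
      rcases hh.eq_or_lt with g | g
      · exact Or.inr ⟨g, h'.trans hi.le⟩
      · exact Or.inl g
  · intro h
    refine Finset.card_lt_card (Finset.ssubset_iff_of_subset ?_ |>.2 ⟨i, ?_, ?_⟩)
    · intro j
      simp only [Finset.mem_filter, Finset.mem_univ, true_and]
      rintro (h1 | ⟨h1, _⟩)
      · exact Or.inl (h1.trans h)
      · exact Or.inl (h1 ▸ h)
    · simp
    · simp only [Finset.mem_filter, Finset.mem_univ, true_and, not_or, not_and, not_lt]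
      exact ⟨h.le, fun e => absurd e h.ne'⟩

lemma desc_iff (p c : ℕ) {n b : ℕ} (hp : 2 ≤ p) (hb : b + 1 = p * c) (A : Fin n → Fin b)
    (i i' : Fin n) (hi : i < i') :
    sigmaLt' (shufflePair p A i') (shufflePair p A i) ↔
      (A i' : ℕ) % p * c + (A i' : ℕ) / p < (A i : ℕ) % p * c + (A i : ℕ) / p := by
  have : NeZero p := ⟨by omega⟩
  rw [phi_lt p c _ _ (by omega) (by omega) (by omega)]
  unfold sigmaLt' shufflePair shuffleCol
  simp only [ZMod.val_natCast, pos_lt A i i' hi, ZMod.natCast_eq_natCast_iff', Fin.lt_def]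

lemma last_iff (p c : ℕ) {n b : ℕ} (hp : 2 ≤ p) (hb : b + 1 = p * c) (A : Fin n → Fin b)
    (i : Fin n) :
    shuffleCol p A i = ((p - 1 : ℕ) : ZMod p) ↔
      b + 1 - c ≤ (A i : ℕ) % p * c + (A i : ℕ) / p := by
  unfold shuffleCol
  rw [ZMod.natCast_eq_natCast_iff', Nat.mod_eq_of_lt (a := p - 1) (by omega)]
  have h1 : (A i : ℕ) / p < c := Nat.div_lt_of_lt_mul (by omega)
  have h2 : (A i : ℕ) % p < p := Nat.mod_lt _ (by omega)
  generalize (A i : ℕ) / p = q at *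
  generalize (A i : ℕ) % p = r at *
  obtain ⟨p, rfl⟩ : ∃ d, p = d + 1 := ⟨p-1, by omega⟩
  have : b + 1 - c = p * c := by rw [hb, add_mul]; omega
  rw [this, Nat.add_sub_cancel]
  constructor
  · rintro rfl; omega
  · intro h
    by_contra hne
    have : (r + 1) * c ≤ p * c := Nat.mul_le_mul_right _ (by omega)
    nlinarith

lemma set_iff (p c n b : ℕ) (hp : 2 ≤ p) (hn : 1 ≤ n) (hb : b + 1 = p * c)
    (S : Finset ℕ) (hS : ∀ t ∈ S, 1 ≤ t ∧ t ≤ n) (hnS : n ∈ S) (A : Fin n → Fin b) :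
    shuffleD'DescentSet p A = S ↔ WEx (· ∈ S) (b + 1 - c) 0 n
      (fun t => if h : t < n then (A ⟨t, h⟩ : ℕ) % p * c + (A ⟨t, h⟩ : ℕ) / p else 0) := by
  have key : shuffleD'DescentSet p A = S ↔
      ∀ i : Fin n, (shuffleHasD'DescentAt p A i ↔ (i : ℕ) + 1 ∈ S) := by
    have hm : ∀ t, t ∈ shuffleD'DescentSet p A ↔
        ∃ i : Fin n, shuffleHasD'DescentAt p A i ∧ (i : ℕ) + 1 = t := by
      intro t
      unfold shuffleD'DescentSet
      simp [Finset.mem_sup]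
    rw [Finset.ext_iff]
    simp only [hm]
    constructor
    · intro h i
      rw [← h]
      constructor
      · intro g; exact ⟨i, g, rfl⟩
      · rintro ⟨j, hj, hji⟩
        have : j = i := Fin.ext (by omega)
        exact this ▸ hj
    · intro h t
      constructor
      · rintro ⟨i, hi, rfl⟩; exact (h i).1 hi
      · intro ht
        have := hS t ht
        refine ⟨⟨t - 1, by omega⟩, (h _).2 ?_, ?_⟩
        · simp only; rwa [show t - 1 + 1 = t by omega]
        · simp only; omega
  rw [key]
  unfold WEx shuffleHasD'DescentAt
  constructor
  · intro h
    constructor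
    · intro t ht ht'
      have := h ⟨t - 1, by omega⟩
      obtain ⟨u, rfl⟩ : ∃ u, t = u + 1 := ⟨t - 1, by omega⟩
      simp only [Nat.add_sub_cancel] at this ⊢
      rw [dif_pos ht', desc_iff p c hp hb A _ _ (by simp [Fin.lt_def])] at this
      rw [dif_pos ht', dif_pos (by omega)]
      exact this
    · have := h ⟨n - 1, by omega⟩
      simp only at this
      rw [dif_neg (by omega), last_iff p c hp hb, show n - 1 + 1 = n by omega] at this
      beta_reduce
      rw [dif_pos (by omega)]
      exact this.2 hnS
  · rintro ⟨h1, h2⟩ i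
    split_ifs with h
    · have := h1 (i+1) (by omega) h
      rw [desc_iff p c hp hb A _ _ (by simp [Fin.lt_def])]
      beta_reduce at this
      rw [dif_pos h, dif_pos (by omega)] at this
      exact this
    · have hi : (i : ℕ) + 1 = n := by omega
      rw [hi, last_iff p c hp hb]
      beta_reduce at h2
      rw [dif_pos (by omega)] at h2
      simp only [hnS, iff_true]
      have : i = ⟨n - 1, by omega⟩ := Fin.ext (by simp only; omega)
      rw [this]; exact h2

lemma count_eq (p c n b : ℕ) (hp : 2 ≤ p) (hn : 1 ≤ n) (hb : b + 1 = p * c)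
    (S : Finset ℕ) (hS : ∀ t ∈ S, 1 ≤ t ∧ t ≤ n) (hnS : n ∈ S) :
    (Finset.univ.filter fun A : Fin n → Fin b => shuffleD'DescentSet p A = S).card =
      WE (· ∈ S) (b + 1 - c) b n 0 := by
  have hc : 0 < c := by
    rcases Nat.eq_zero_or_pos c with rfl | h
    · omega
    · exact h
  rw [← Set.ncard_coe_finset]
  unfold WE
  refine Set.ncard_congr (fun A _ => fun t => if h : t < n then
    (A ⟨t, h⟩ : ℕ) % p * c + (A ⟨t, h⟩ : ℕ) / p else 0) ?_ ?_ ?_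
  · intro A hA
    simp only [Finset.coe_filter, Finset.mem_univ, true_and, Set.mem_ofPred_eq] at hA
    refine ⟨⟨?_, ?_⟩, (set_iff p c n b hp hn hb S hS hnS A).1 hA⟩
    · intro t _ ht
      simp only [dif_pos ht]
      exact phi_bound p c b _ hp hb (Fin.is_lt _)
    · intro t ht
      simp only
      rw [dif_neg (by omega)]
  · intro A A' _ _ h
    funext i
    have := congrFun h i
    simp only [Fin.is_lt, dif_pos, Fin.eta] at this
    have l1 := phi_lt p c (A i) (A' i) (by omega) (by omega) (by omega)
    have l2 := phi_lt p c (A' i) (A i) (by omega) (by omega) (by omega)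
    apply Fin.ext
    omega
  · rintro x ⟨⟨h1, h2⟩, h3⟩
    have hlt : ∀ y, y < b → y % c * p + y / c < b := fun y hy => by
      by_cases hc1 : c = 1
      · subst hc1; simpa [Nat.mod_one] using hy
      · exact phi_bound c p b y (by omega) (by rw [hb, mul_comm]) hy
    have hx : (fun t => if h : t < n then
        (x t % c * p + x t / c) % p * c + (x t % c * p + x t / c) / p else 0) = x := by
      funext t
      split_ifs with h
      · exact phi_inv p c _ hc (by omega) (by have := h1 t (by omega) h; omega)
      · exact (h2 t (by omega)).symm
    refine ⟨fun i => ⟨x i % c * p + x i / c, hlt _ (h1 i (by omega) i.2)⟩, ?_, hx⟩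
    simp only [Finset.coe_filter, Finset.mem_univ, true_and, Set.mem_ofPred_eq]
    rw [set_iff p c n b hp hn hb S hS hnS]
    simp only
    rw [hx]
    exact h3

/-- **Theorem (determinantal formula for the `(b,n,p)`-shuffle, `b = pc - 1`, case `s_k = n`).**
For `b = pc - 1` and `0 = s_0 < s_1 < ⋯ < s_{k-1} < s_k = n`, the probability that
the d′-descent set of the `(b,n,p)`-shuffle equals `{s_1,…,s_{k-1},n}` is
`b⁻ⁿ · det(f′(i,j))_{i,j=0,…,k-1}` with `f′(i,j) = binom(s_{j+1} - s_i + b - 1, b-1)` for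
`j ≤ k-2` and `f′(i,k-1) = binom(n - s_i + b - 1, b-1) - binom(n - s_i + b - c, b - c)`. -/
theorem statement3 (p c n k : ℕ) (hp : 2 ≤ p) (hc : 1 ≤ c) (hn : 1 ≤ n) (hk : 1 ≤ k)
    (b : ℕ) (hb : b + 1 = p * c)
    (s : ℕ → ℕ) (hs0 : s 0 = 0) (hmono : ∀ i, i < k → s i < s (i + 1))
    (hlast : s k = n) :
    ((Finset.univ.filter fun A : Fin n → Fin b =>
        shuffleD'DescentSet p A = (Finset.Icc 1 k).image s).card : ℝ) / (b : ℝ) ^ n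
      = ((b : ℝ) ^ n)⁻¹ *
        (Matrix.of fun i j : Fin k =>
          if (j : ℕ) = k - 1 then
            (zchoose ((n : ℤ) - s (i : ℕ) + b - 1) (b - 1) : ℝ)
              - (zchoose ((n : ℤ) - s (i : ℕ) + (b - c : ℕ)) (b - c) : ℝ)
          else (zchoose ((s ((j : ℕ) + 1) : ℤ) - s (i : ℕ) + b - 1) (b - 1) : ℝ)).det := by
  obtain ⟨K, rfl⟩ : ∃ K, k = K + 1 := ⟨k - 1, by omega⟩
  have hsm : ∀ i j, i < j → j ≤ K + 1 → s i < s j := by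
    intro i j hij
    induction j, hij using Nat.le_induction with
    | base => intro h; exact hmono i (by omega)
    | succ j hj ih => intro h; exact (ih (by omega)).trans (hmono j (by omega))
  have hb1 : 1 ≤ b := by nlinarith
  have hcb : c ≤ b := by nlinarith
  set S := (Finset.Icc 1 (K+1)).image s with hSdef
  have hmem : ∀ t, t ∈ S ↔ ∃ j, (1 ≤ j ∧ j ≤ K + 1) ∧ s j = t := by
    intro t; simp [hSdef]
  have hS : ∀ t ∈ S, 1 ≤ t ∧ t ≤ n := by
    intro t ht
    obtain ⟨j, ⟨h1, h2⟩, rfl⟩ := (hmem t).1 ht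
    have := hsm 0 j (by omega) h2
    rcases h2.eq_or_lt with rfl | h
    · omega
    · have := hsm j (K+1) h le_rfl
      omega
  have hnS : n ∈ S := (hmem n).2 ⟨K+1, by omega, hlast⟩
  have hgap : ∀ j, j ≤ K → ∀ t, s j < t → t < s (j+1) → ¬ t ∈ S := by
    intro j hj t h1 h2 ht
    obtain ⟨l, ⟨_, h3⟩, rfl⟩ := (hmem t).1 ht
    rcases lt_trichotomy l j with h | rfl | h
    · have := hsm l j h (by omega); omega
    · omega
    · rcases (Nat.succ_le_of_lt h).eq_or_lt with h' | h'
      · rw [← h'] at h2; simp at h2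
      · have := hsm (j+1) l h' h3; omega
  have hsle : ∀ j, j ≤ K + 1 → s j ≤ n := by
    intro j hj
    rcases hj.eq_or_lt with rfl | h
    · omega
    · have := hsm j (K+1) h le_rfl
      omega
  rw [count_eq p c n b hp hn hb S hS hnS, div_eq_inv_mul]
  congr 1
  have hdet := fun M => det_hess K M
    (fun i j => (WW (· ∈ S) (b + 1 - c) b n (s i) (s j) : ℝ))
  rw [hdet]
  · rw [hs0, ← WE_eq]
    · have := hsm 0 1 (by omega) (by omega); omega
    · have := hgap 0 (by omega); rwa [hs0] at this
    · exact hsle 1 (by omega)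
  · intro i j hj hij
    simp only [Matrix.of_apply]
    rw [if_neg (by omega), zchoose_neg b hb1]
    · simp
    · have := hsm _ _ hij (by omega); omega
  · intro i j hj hij
    simp only [Matrix.of_apply]
    rw [if_neg (by omega), zchoose_multi b 0 hb1]
    · simp
    · rw [hij]; simp
  · intro i j hj hij
    have hij' : (i : ℕ) ≤ j := hij
    simp only [Matrix.of_apply]
    have l1 := hsm i (j+1) (by omega) (by omega)
    have l2 := hsm (j+1) (j+2) (by omega) (by omega)
    have l3 := hsle (j+2) (by omega)
    rw [if_neg (by omega), zchoose_multi b (s (j+1) - s i) hb1 _ (by omega),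
      ← WE_eq _ _ _ _ _ _ l2 (hgap (j+1) (by omega)) l3]
    exact_mod_cast WW_step (· ∈ S) (b + 1 - c) b n (s i) (s (j+1)) (s (j+2)) l1 l2 l3
      ((hmem _).2 ⟨j+1, by omega, rfl⟩) (hgap (j+1) (by omega))
  · intro i
    simp only [Matrix.of_apply, Fin.val_last]
    have l1 := hsm i (K+1) (by omega) le_rfl
    have := WW_last (· ∈ S) (b + 1 - c) b n (s i) (by omega) (by omega)
    rw [if_pos (by omega), zchoose_multi b (n - s i) hb1 _ (by omega)]
    have e : ((n : ℤ) - s (i : ℕ) + (b - c : ℕ)) = ((n : ℤ) - s i) + (b + 1 - c : ℕ) - 1 := by omega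
    rw [e, show b - c = (b + 1 - c) - 1 by omega,
      zchoose_multi (b + 1 - c) (n - s i) (by omega) _ (by omega), this, hlast]
    push_cast
    ring
end
end

section
/- Let p ≥ 2 and let σ be chosen uniformly at random from G_{p,n}. Let 0 = s_0 < s_1 < ⋯ < s_k < n and set s_{k+1} := n. Then the probability that the set of d′-descents of σ equals {s_1,…,s_k} is det( g′(i,j) )_{i,j = 0,…,k}, where g′(i,j) = 1/(s_{j+1} − s_i)! for 0 ≤ i ≤ k and 0 ≤ j ≤ k−1, and g′(i,k) = ((p−1)/p)^{n − s_i} / (n − s_i)! for 0 ≤ i ≤ k. -/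
open scoped Classical

noncomputable section

/-- `1/m!` for an integer `m`, taken to be `0` for negative `m`. -/
def invFact (m : ℤ) : ℝ := if 0 ≤ m then ((m.toNat).factorial : ℝ)⁻¹ else 0

/-- An element of `G_{p,n}`, given by its permutation part and its colors;
`σ` is determined by the pairs `(σ(i), σ_c(i))`. -/
abbrev ColoredPerm (p n : ℕ) := Equiv.Perm (Fin n) × (Fin n → ZMod p)

/-- The pair `(σ(i), σ_c(i)) ∈ {1,…,n} × Z_p`. -/
def cpPair {p n : ℕ} (σ : ColoredPerm p n) (i : Fin n) : ℕ × ZMod p :=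
  ((σ.1 i : ℕ) + 1, σ.2 i)

/-- `σ ∈ G_{p,n}` has a d-descent at position `i+1` (positions are `1,…,n`):
for positions `< n` this means `(σ(i),σ_c(i)) > (σ(i+1),σ_c(i+1))`,
and at position `n` it means `σ_c(n) ≠ 0`. -/
def cpHasDDescentAt {p n : ℕ} (σ : ColoredPerm p n) (i : Fin n) : Prop :=
  if h : (i : ℕ) + 1 < n then
    sigmaLt p (cpPair σ ⟨(i : ℕ) + 1, h⟩) (cpPair σ i)
  else σ.2 i ≠ 0

/-- The set of d-descent positions (a subset of `{1,…,n}`) of `σ ∈ G_{p,n}`. -/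
def cpDDescentSet {p n : ℕ} (σ : ColoredPerm p n) : Finset ℕ :=
  (Finset.univ.filter fun i : Fin n => cpHasDDescentAt σ i).image fun i => (i : ℕ) + 1

/-- `σ ∈ G_{p,n}` has a d′-descent at position `i+1` (positions are `1,…,n`):
for positions `< n` this means `(σ(i),σ_c(i)) >′ (σ(i+1),σ_c(i+1))`,
and at position `n` it means `σ_c(n) = p - 1`. -/
def cpHasD'DescentAt {p n : ℕ} (σ : ColoredPerm p n) (i : Fin n) : Prop :=
  if h : (i : ℕ) + 1 < n then
    sigmaLt' (cpPair σ ⟨(i : ℕ) + 1, h⟩) (cpPair σ i)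
  else σ.2 i = ((p - 1 : ℕ) : ZMod p)

/-- The set of d′-descent positions (a subset of `{1,…,n}`) of `σ ∈ G_{p,n}`. -/
def cpD'DescentSet {p n : ℕ} (σ : ColoredPerm p n) : Finset ℕ :=
  (Finset.univ.filter fun i : Fin n => cpHasD'DescentAt σ i).image fun i => (i : ℕ) + 1


def blkOf (T : Finset ℕ) (i : ℕ) : ℕ := (T.filter (· ≤ i)).card

theorem blkOf_mono (T : Finset ℕ) : Monotone (blkOf T) := by
  intro i j h
  apply Finset.card_le_card
  intro x hx
  simp only [Finset.mem_filter] at hx ⊢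
  exact ⟨hx.1, hx.2.trans h⟩

theorem blkOf_succ_mem (T : Finset ℕ) (i : ℕ) (h : i + 1 ∈ T) : blkOf T i < blkOf T (i + 1) := by
  apply Finset.card_lt_card
  rw [Finset.ssubset_iff_of_subset]
  · exact ⟨i + 1, by simp [h], by simp⟩
  · intro x hx
    simp only [Finset.mem_filter] at hx ⊢
    exact ⟨hx.1, by omega⟩

theorem blkOf_succ_not_mem (T : Finset ℕ) (i : ℕ) (h : i + 1 ∉ T) :
    blkOf T (i + 1) = blkOf T i := by
  unfold blkOf
  congr 1
  ext x
  simp only [Finset.mem_filter]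
  constructor
  · rintro ⟨hx, hx'⟩
    refine ⟨hx, ?_⟩
    rcases Nat.lt_or_ge x (i + 1) with h1 | h1
    · omega
    · have : x = i + 1 := by omega
      exact absurd (this ▸ hx) h
  · rintro ⟨hx, hx'⟩
    exact ⟨hx, by omega⟩

def keyOf {p n : ℕ} (T : Finset ℕ) (σ : ColoredPerm p n) (i : Fin n) : ℕ ×ₗ (ℕ ×ₗ ℕ) :=
  toLex (blkOf T i, toLex ((σ.2 i).val, ((σ.1 i : Fin n) : ℕ)))

theorem fin_strictMono {α : Type*} [Preorder α] {n : ℕ} (f : Fin n → α) :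
    StrictMono f ↔ ∀ (i : Fin n) (h : (i : ℕ) + 1 < n), f i < f ⟨(i : ℕ) + 1, h⟩ := by
  constructor
  · intro hf i h
    exact hf (by simp [Fin.lt_def])
  · intro h
    cases n with
    | zero => intro i; exact i.elim0
    | succ m =>
      rw [Fin.strictMono_iff_lt_succ]
      intro i
      exact h i.castSucc (by simp)

theorem mem_desc' {p n : ℕ} (σ : ColoredPerm p n) (x : ℕ) :
    x ∈ cpD'DescentSet σ ↔ ∃ j : Fin n, cpHasD'DescentAt σ j ∧ (j : ℕ) + 1 = x := by
  unfold cpD'DescentSet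
  simp [Finset.bind_def]

theorem mem_desc {p n : ℕ} (σ : ColoredPerm p n) (i : Fin n) :
    (i : ℕ) + 1 ∈ cpD'DescentSet σ ↔ cpHasD'DescentAt σ i := by
  rw [mem_desc']
  constructor
  · rintro ⟨j, hj, h⟩
    have : j = i := Fin.ext (by omega)
    exact this ▸ hj
  · intro h; exact ⟨i, h, rfl⟩

theorem desc_sub_iff {p n : ℕ} [NeZero p] (T : Finset ℕ) (hT : ∀ t ∈ T, t < n)
    (σ : ColoredPerm p n) :
    cpD'DescentSet σ ⊆ T ↔
      StrictMono (keyOf T σ) ∧ ∀ i : Fin n, (i : ℕ) + 1 = n → σ.2 i ≠ ((p - 1 : ℕ) : ZMod p) := by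
  have h1 : cpD'DescentSet σ ⊆ T ↔ ∀ i : Fin n, cpHasD'DescentAt σ i → (i : ℕ) + 1 ∈ T := by
    constructor
    · intro h i hi
      exact h ((mem_desc σ i).2 hi)
    · intro h x hx
      rw [mem_desc'] at hx
      obtain ⟨j, hj, rfl⟩ := hx
      exact h j hj
  rw [h1, fin_strictMono]
  have key : ∀ (i : Fin n) (h : (i : ℕ) + 1 < n),
      (cpHasD'DescentAt σ i → (i : ℕ) + 1 ∈ T) ↔ keyOf T σ i < keyOf T σ ⟨(i : ℕ) + 1, h⟩ := by
    intro i h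
    have hne : ((σ.1 i : Fin n) : ℕ) ≠ ((σ.1 ⟨(i : ℕ) + 1, h⟩ : Fin n) : ℕ) := by
      intro e
      have := congrArg Fin.val (σ.1.injective (Fin.ext e))
      simp at this
    have hval : ∀ a b : ZMod p, a = b ↔ a.val = b.val := fun a b =>
      (ZMod.val_injective p).eq_iff.symm
    unfold cpHasD'DescentAt keyOf sigmaLt' cpPair
    rw [dif_pos h]
    simp only [Prod.Lex.toLex_lt_toLex, hval]
    by_cases hm : (i : ℕ) + 1 ∈ T
    · simp [hm, blkOf_succ_mem T i hm]
    · simp only [hm, blkOf_succ_not_mem T i hm, imp_false, true_and, lt_self_iff_false, false_or]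
      omega
  constructor
  · intro h
    refine ⟨fun i hi => (key i hi).1 (h i), ?_⟩
    intro i hi hc
    have : cpHasD'DescentAt σ i := by
      unfold cpHasD'DescentAt
      rw [dif_neg (by omega)]
      exact hc
    have := hT _ (h i this)
    omega
  · rintro ⟨h, h'⟩ i
    by_cases hi : (i : ℕ) + 1 < n
    · exact (key i hi).2 (h i hi)
    · intro hd
      unfold cpHasD'DescentAt at hd
      rw [dif_neg hi] at hd
      exact absurd hd (h' i (by omega))

theorem perm_strictMono {n : ℕ} (ρ : Equiv.Perm (Fin n)) (h : StrictMono ρ) : ρ = 1 := by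
  have h1 : Tuple.sort (id : Fin n → Fin n) = Tuple.sort (id : Fin n → Fin n) := rfl
  have := Tuple.unique_monotone (f := (id : Fin n → Fin n)) (σ := ρ) (τ := 1)
    h.monotone (fun a b hab => hab)
  ext i
  simpa using congrArg Fin.val (congrFun this i)

def cpAct {p n : ℕ} (σ : ColoredPerm p n) (τ : Equiv.Perm (Fin n)) : ColoredPerm p n :=
  (σ.1 * τ, σ.2 ∘ τ)

theorem keyOf_act {p n : ℕ} (T : Finset ℕ) (σ : ColoredPerm p n) (τ : Equiv.Perm (Fin n))
    (h : ∀ i, blkOf T (τ i) = blkOf T i) : keyOf T (cpAct σ τ) = keyOf T σ ∘ τ := by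
  funext i
  simp [keyOf, cpAct, h i]

theorem keyOf_inj {p n : ℕ} (T : Finset ℕ) (σ : ColoredPerm p n) :
    Function.Injective (keyOf T σ) := by
  intro i j h
  unfold keyOf at h
  have := congrArg (fun x => (ofLex (ofLex x).2).2) h
  exact σ.1.injective (Fin.ext this)

/-- `a` is the maximum of `T ∪ {0}`, with `T` made of positive numbers. -/
def TopOf (T : Finset ℕ) (a : ℕ) : Prop :=
  (∀ t ∈ T, t ≤ a) ∧ (a ∈ T ∨ (a = 0 ∧ T = ∅))

theorem TopOf.blk_eq_iff {T : Finset ℕ} {a : ℕ} (h : TopOf T a) (i : ℕ) :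
    blkOf T i = T.card ↔ a ≤ i := by
  constructor
  · intro h1
    rcases h.2 with h2 | ⟨h2, -⟩
    · have : T.filter (· ≤ i) = T := Finset.eq_of_subset_of_card_le (Finset.filter_subset _ _) h1.ge
      rw [← this] at h2
      exact (Finset.mem_filter.1 h2).2
    · omega
  · intro h1
    unfold blkOf
    rw [Finset.filter_true_of_mem]
    intro t ht
    exact (h.1 t ht).trans h1

theorem val_eq_iff {p : ℕ} (hp : 2 ≤ p) (c : ZMod p) :
    c = ((p - 1 : ℕ) : ZMod p) ↔ c.val = p - 1 := by
  haveI : NeZero p := ⟨by omega⟩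
  rw [← (ZMod.val_injective p).eq_iff, ZMod.val_natCast, Nat.mod_eq_of_lt (by omega)]

theorem card_mul {p n : ℕ} [NeZero p] (hp : 2 ≤ p) (T : Finset ℕ) (a : ℕ) (hT : ∀ t ∈ T, t < n)
    (ha : TopOf T a) :
    (Finset.univ.filter fun σ : ColoredPerm p n => cpD'DescentSet σ ⊆ T).card *
      (Finset.univ.filter fun τ : Equiv.Perm (Fin n) => ∀ i, blkOf T (τ i) = blkOf T i).card =
    (Finset.univ.filter fun σ : ColoredPerm p n =>
      ∀ i : Fin n, a ≤ i → σ.2 i ≠ ((p - 1 : ℕ) : ZMod p)).card := by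
  rw [← Finset.card_product]
  apply Finset.card_bij (fun x _ => cpAct x.1 x.2)
  · rintro ⟨σ, τ⟩ h
    simp only [Finset.mem_product, Finset.mem_filter, Finset.mem_univ, true_and] at h ⊢
    obtain ⟨h1, h2⟩ := h
    rw [desc_sub_iff T hT] at h1
    obtain ⟨h1, h3⟩ := h1
    intro i hi
    have hτ : a ≤ ((τ i : Fin n) : ℕ) := by
      rw [← ha.blk_eq_iff, h2, ha.blk_eq_iff]; exact hi
    show σ.2 (τ i) ≠ _
    generalize τ i = j at hτ
    have hl := h3 ⟨n - 1, by omega⟩ (by simp; omega)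
    by_cases hj : (j : ℕ) = n - 1
    · have : j = ⟨n - 1, by omega⟩ := Fin.ext hj
      rwa [this]
    · have hlt : j < ⟨n - 1, by omega⟩ := by rw [Fin.lt_def]; simp; omega
      have := h1 hlt
      unfold keyOf at this
      simp only [Prod.Lex.toLex_lt_toLex] at this
      rw [(ha.blk_eq_iff _).2 hτ, (ha.blk_eq_iff _).2 (show a ≤ n - 1 by omega)] at this
      rw [Ne, val_eq_iff hp] at hl ⊢
      have hv := ZMod.val_lt (σ.2 ⟨n - 1, by omega⟩)
      omega
  · rintro ⟨σ, τ⟩ h ⟨σ', τ'⟩ h' he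
    simp only [Finset.mem_product, Finset.mem_filter, Finset.mem_univ, true_and] at h h'
    rw [desc_sub_iff T hT] at h h'
    obtain ⟨⟨h1, -⟩, h2⟩ := h
    obtain ⟨⟨h1', -⟩, h2'⟩ := h'
    simp only [cpAct, Prod.mk.injEq] at he
    obtain ⟨e1, e2⟩ := he
    have hρ : ∀ i, blkOf T ((τ * τ'⁻¹) i) = blkOf T i := by
      intro i
      have := h2' (τ'⁻¹ i)
      simp at this
      simp [h2, this]
    have hσ : σ' = cpAct σ (τ * τ'⁻¹) := by
      apply Prod.ext
      · simp [cpAct, ← mul_assoc, e1]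
      · funext i
        have := congrFun e2 (τ'⁻¹ i)
        simpa [cpAct] using this.symm
    have hk := keyOf_act T σ (τ * τ'⁻¹) hρ
    rw [← hσ] at hk
    have h3 : StrictMono (τ * τ'⁻¹) := by
      intro i j hij
      have := h1' hij
      rw [hk] at this
      exact h1.lt_iff_lt.1 this
    have h4 := perm_strictMono _ h3
    rw [h4] at hσ
    have h5 : τ = τ' := mul_inv_eq_one.1 h4
    rw [hσ, h5]
    simp [cpAct]
  · intro σ hσ
    simp only [Finset.mem_filter, Finset.mem_univ, true_and] at hσ
    set τ := Tuple.sort (keyOf T σ) with hτ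
    have h1 : Monotone (keyOf T σ ∘ τ) := Tuple.monotone_sort _
    have h2 : StrictMono (keyOf T σ ∘ τ) :=
      h1.strictMono_of_injective ((keyOf_inj T σ).comp τ.injective)
    have h3 : Monotone ((fun i : Fin n => blkOf T i) ∘ τ) := by
      intro i j hij
      exact Prod.Lex.monotone_fst _ _ (h1 hij)
    have h4 := Tuple.unique_monotone (f := (fun i : Fin n => blkOf T i)) (σ := τ) (τ := 1) h3
      (fun i j hij => blkOf_mono T hij)
    have h5 : ∀ i, blkOf T (τ i) = blkOf T i := fun i => congrFun h4 i
    have h6 : ∀ i, blkOf T (τ⁻¹ i) = blkOf T i := by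
      intro i
      have := h5 (τ⁻¹ i)
      simp at this
      exact this.symm
    refine ⟨(cpAct σ τ, τ⁻¹), ?_, ?_⟩
    · simp only [Finset.mem_product, Finset.mem_filter, Finset.mem_univ, true_and]
      refine ⟨?_, h6⟩
      rw [desc_sub_iff T hT, keyOf_act T σ τ h5]
      refine ⟨h2, ?_⟩
      intro i hi
      apply hσ
      rw [← ha.blk_eq_iff, h5, ha.blk_eq_iff]
      rcases ha.2 with h | ⟨h, -⟩
      · have := hT _ h
        omega
      · omega
    · apply Prod.ext
      · simp [cpAct]
      · funext i
        simp [cpAct]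

theorem card_colors {p n : ℕ} [NeZero p] (a : ℕ) (ha : a ≤ n) :
    (Finset.univ.filter fun σ : ColoredPerm p n =>
      ∀ i : Fin n, a ≤ i → σ.2 i ≠ ((p - 1 : ℕ) : ZMod p)).card =
    n.factorial * (p ^ a * (p - 1) ^ (n - a)) := by
  have : (Finset.univ.filter fun σ : ColoredPerm p n =>
      ∀ i : Fin n, a ≤ i → σ.2 i ≠ ((p - 1 : ℕ) : ZMod p)) =
      (Finset.univ : Finset (Equiv.Perm (Fin n))) ×ˢ
        Fintype.piFinset (fun i : Fin n => if a ≤ (i : ℕ) then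
          (Finset.univ.erase ((p - 1 : ℕ) : ZMod p)) else Finset.univ) := by
    ext σ
    simp only [Finset.mem_filter, Finset.mem_univ, true_and, Finset.mem_product,
      Fintype.mem_piFinset]
    apply forall_congr'
    intro i
    split_ifs with h <;> simp [h]
  rw [this, Finset.card_product, Fintype.card_piFinset, Finset.card_univ, Fintype.card_perm,
    Fintype.card_fin]
  congr 1
  have : ∀ i : Fin n, (if a ≤ (i : ℕ) then
          (Finset.univ.erase ((p - 1 : ℕ) : ZMod p)) else Finset.univ).card =
      (fun i : ℕ => if a ≤ i then p - 1 else p) i := by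
    intro i
    split_ifs with h <;> simp [h, Finset.card_erase_of_mem, ZMod.card]
  rw [Finset.prod_congr rfl (fun i _ => this i), Fin.prod_univ_eq_prod_range
    (fun i : ℕ => if a ≤ i then p - 1 else p)]
  obtain ⟨b, rfl⟩ := Nat.exists_eq_add_of_le ha
  rw [Finset.prod_range_add]
  congr 1
  · rw [Finset.prod_congr rfl (g := fun _ => p)]
    · simp
    · intro i hi
      simp at hi
      rw [if_neg (by omega)]
  · simp

def fibProd (n : ℕ) (T : Finset ℕ) : ℕ :=
  ∏ j ∈ Finset.range T.card, ((Finset.range n).filter fun i => blkOf T i = j).card.factorial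

theorem card_stab (n : ℕ) (T : Finset ℕ) (a : ℕ) (ha : TopOf T a) (han : a ≤ n) :
    (Finset.univ.filter fun τ : Equiv.Perm (Fin n) => ∀ i, blkOf T (τ i) = blkOf T i).card =
      fibProd n T * (n - a).factorial := by
  have hle : ∀ i, blkOf T i < T.card + 1 := fun i =>
    Nat.lt_succ_of_le (Finset.card_le_card (Finset.filter_subset _ _))
  have h := DomMulAct.stabilizer_card (fun i : Fin n => (⟨blkOf T i, hle i⟩ : Fin (T.card + 1)))
  rw [Fintype.card_subtype] at h
  have e : (Finset.univ.filter fun τ : Equiv.Perm (Fin n) => ∀ i, blkOf T (τ i) = blkOf T i) =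
      Finset.univ.filter fun g : Equiv.Perm (Fin n) =>
        (fun i : Fin n => (⟨blkOf T i, hle i⟩ : Fin (T.card + 1))) ∘ g =
          (fun i : Fin n => (⟨blkOf T i, hle i⟩ : Fin (T.card + 1))) := by
    ext g
    simp [funext_iff]
  have hf : ∀ j, Fintype.card {i : Fin n // (⟨blkOf T i, hle i⟩ : Fin (T.card + 1)) = j} =
      ((Finset.range n).filter fun i => blkOf T i = (j : ℕ)).card := by
    intro j
    rw [Fintype.card_subtype]
    apply Finset.card_bij (fun (i : Fin n) _ => (i : ℕ))
    · intro i hi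
      simp [Fin.ext_iff] at hi
      simp [hi]
    · intro i _ i' _ h
      exact Fin.ext h
    · intro b hb
      simp at hb
      exact ⟨⟨b, hb.1⟩, by simp [Fin.ext_iff, hb.2], rfl⟩
  rw [e]
  convert h using 1
  simp only [hf]
  rw [Fin.prod_univ_eq_prod_range (fun j : ℕ =>
    ((Finset.range n).filter fun i => blkOf T i = j).card.factorial), Finset.prod_range_succ]
  unfold fibProd
  congr 2
  simp only [ha.blk_eq_iff]
  have : (Finset.range n).filter (fun i => a ≤ i) = Finset.Ico a n := by
    ext i; simp; omega
  rw [this, Nat.card_Ico]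

theorem TopOf.insert {T : Finset ℕ} {a e : ℕ} (h : TopOf T a) (he : a < e) :
    TopOf (insert e T) e := by
  refine ⟨?_, Or.inl (Finset.mem_insert_self _ _)⟩
  intro t ht
  rcases Finset.mem_insert.1 ht with rfl | ht
  · exact le_rfl
  · exact (h.1 t ht).trans he.le

theorem TopOf.not_mem {T : Finset ℕ} {a e : ℕ} (h : TopOf T a) (he : a < e) : e ∉ T := fun h1 => by
  have := h.1 _ h1
  omega

theorem fibProd_insert (n : ℕ) (T : Finset ℕ) (a e : ℕ) (ha : TopOf T a) (he : a < e)
    (hen : e ≤ n) : fibProd n (insert e T) = fibProd n T * (e - a).factorial := by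
  have hb : ∀ i, blkOf (insert e T) i = blkOf T i + if e ≤ i then 1 else 0 := by
    intro i
    unfold blkOf
    rw [Finset.filter_insert]
    split_ifs with h
    · rw [Finset.card_insert_of_notMem]
      simp [ha.not_mem he]
    · rfl
  have hle : ∀ i, blkOf T i ≤ T.card := fun i => (Finset.card_le_card (Finset.filter_subset _ _))
  unfold fibProd
  rw [Finset.card_insert_of_notMem (ha.not_mem he), Finset.prod_range_succ]
  congr 1
  · apply Finset.prod_congr rfl
    intro j hj
    simp only [Finset.mem_range] at hj
    congr 2
    apply Finset.filter_congr
    intro i _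
    rw [hb]
    have := ha.blk_eq_iff i
    split_ifs with h
    · have := this.2 (by omega)
      omega
    · omega
  · congr 1
    have : (Finset.range n).filter (fun i => blkOf (insert e T) i = T.card) = Finset.Ico a e := by
      ext i
      simp only [Finset.mem_filter, Finset.mem_range, Finset.mem_Ico, hb]
      have := ha.blk_eq_iff i
      split_ifs with h
      · have := this.2 (by omega)
        omega
      · simp only [add_zero, this]
        omega
    rw [this, Nat.card_Ico]

theorem fibProd_pos (n : ℕ) (T : Finset ℕ) : 0 < fibProd n T :=
  Finset.prod_pos fun _ _ => Nat.factorial_pos _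

theorem alpha_eq {p n : ℕ} [NeZero p] (hp : 2 ≤ p) (T : Finset ℕ) (a : ℕ) (hT : ∀ t ∈ T, t < n)
    (han : a ≤ n) (ha : TopOf T a) :
    ((Finset.univ.filter fun σ : ColoredPerm p n => cpD'DescentSet σ ⊆ T).card : ℝ) =
      (Fintype.card (ColoredPerm p n) : ℝ) * (fibProd n T : ℝ)⁻¹ *
        ((((p : ℝ) - 1) / p) ^ (n - a) * invFact ((n : ℤ) - a)) := by
  have h := card_mul hp T a hT ha
  rw [card_colors a han, card_stab n T a ha han] at h
  have h' := congrArg (Nat.cast : ℕ → ℝ) h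
  have hN : Fintype.card (ColoredPerm p n) = n.factorial * p ^ n := by
    simp [ColoredPerm, Fintype.card_perm, ZMod.card]
  have hi : invFact ((n : ℤ) - a) = ((n - a).factorial : ℝ)⁻¹ := by
    unfold invFact
    rw [if_pos (by omega)]
    congr 3
    omega
  have hf : (fibProd n T : ℝ) ≠ 0 := by exact_mod_cast (fibProd_pos n T).ne'
  have hf2 : ((n - a).factorial : ℝ) ≠ 0 := by exact_mod_cast (Nat.factorial_pos _).ne'
  have hp0 : (p : ℝ) ≠ 0 := by exact_mod_cast (NeZero.ne p)
  have hpn : (p : ℝ) ^ n = p ^ a * p ^ (n - a) := by rw [← pow_add]; congr 1; omega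
  rw [hN, hi]
  push_cast [Nat.cast_sub (show 1 ≤ p by omega)] at h' ⊢
  rw [hpn, div_pow]
  field_simp
  linear_combination h'

def cCount (p n : ℕ) [NeZero p] (T E : Finset ℕ) : ℕ :=
  (Finset.univ.filter fun σ : ColoredPerm p n =>
    cpD'DescentSet σ ⊆ T ∪ E ∧ E ⊆ cpD'DescentSet σ).card

theorem cCount_insert (p n : ℕ) [NeZero p] (T E : Finset ℕ) (e : ℕ) (h1 : e ∉ T) (h2 : e ∉ E) :
    (cCount p n T (insert e E) : ℝ) = cCount p n (insert e T) E - cCount p n T E := by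
  rw [eq_sub_iff_add_eq]
  unfold cCount
  norm_cast
  rw [← Finset.card_union_of_disjoint]
  · congr 1
    ext σ
    simp only [Finset.mem_union, Finset.mem_filter, Finset.mem_univ, true_and,
      Finset.insert_subset_iff, Finset.union_insert, Finset.insert_union]
    constructor
    · rintro (⟨h, h', h''⟩ | ⟨h, h'⟩)
      · exact ⟨h, h''⟩
      · exact ⟨h.trans (Finset.subset_insert _ _), h'⟩
    · rintro ⟨h, h'⟩
      by_cases he : e ∈ cpD'DescentSet σ
      · exact Or.inl ⟨h, he, h'⟩
      · exact Or.inr ⟨(Finset.subset_insert_iff_of_notMem he).1 h, h'⟩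
  · rw [Finset.disjoint_left]
    intro σ h h'
    simp only [Finset.mem_filter, Finset.mem_univ, true_and,
      Finset.insert_subset_iff] at h h'
    have := h'.1 h.2.1
    simp [h1, h2] at this

def gMat (g : ℕ → ℕ → ℝ) (d a j : ℕ) : Matrix (Fin (d + 1)) (Fin (d + 1)) ℝ :=
  Matrix.of fun r c => g (if (r : ℕ) = 0 then a else j + r) (j + c)

theorem gMat_det (g : ℕ → ℕ → ℝ) (d a j : ℕ) (h1 : g (j + 1) j = 1)
    (h0 : ∀ r, 2 ≤ r → r ≤ d + 1 → g (j + r) j = 0) :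
    (gMat g (d + 1) a j).det =
      g a j * (gMat g d (j + 1) (j + 1)).det - (gMat g d a (j + 1)).det := by
  rw [Matrix.det_succ_column_zero, Fin.sum_univ_succ, Fin.sum_univ_succ]
  rw [Finset.sum_eq_zero]
  · have e1 : (gMat g (d + 1) a j).submatrix (Fin.succAbove 0) Fin.succ =
        gMat g d (j + 1) (j + 1) := by
      ext r c
      simp only [gMat, Matrix.submatrix_apply, Matrix.of_apply, Fin.succAbove_zero, Fin.val_succ]
      congr 1
      · rw [if_neg (by omega)]
        split_ifs <;> omega
      · omega
    have e2 : (gMat g (d + 1) a j).submatrix (Fin.succAbove (Fin.succ 0)) Fin.succ =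
        gMat g d a (j + 1) := by
      ext r c
      simp only [gMat, Matrix.submatrix_apply, Matrix.of_apply, Fin.val_succ]
      congr 1
      · refine Fin.cases ?_ (fun r => ?_) r
        · simp
        · simp [Fin.succ_succAbove_succ]
          omega
      · omega
    rw [e1, e2]
    simp [gMat, h1]
    ring
  · intro i _
    have : gMat g (d + 1) a j i.succ.succ 0 = 0 := by
      simp only [gMat, Matrix.of_apply, Fin.val_succ]
      have := i.isLt
      simpa using h0 (i + 1 + 1) (by omega) (by omega)
    rw [this]
    simp

theorem s_lt {k : ℕ} {s : ℕ → ℕ} (hmono : ∀ i, i ≤ k → s i < s (i + 1)) {i j : ℕ} (h : i < j)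
    (hj : j ≤ k + 1) : s i < s j := by
  induction j, h using Nat.le_induction with
  | base => exact hmono i (by omega)
  | succ m hm ih => exact (ih (by omega)).trans (hmono m (by omega))

theorem main_ind (p n k : ℕ) [NeZero p] (hp : 2 ≤ p)
    (s : ℕ → ℕ) (hmono : ∀ i, i ≤ k → s i < s (i + 1)) (hlast : s (k + 1) = n)
    (g : ℕ → ℕ → ℝ)
    (hg : g = fun i j => if j = k then
            (((p : ℝ) - 1) / p) ^ (n - s i) * invFact ((n : ℤ) - s i)
          else invFact ((s (j + 1) : ℤ) - s i)) :
    ∀ d j a (T : Finset ℕ), j + d = k → a ≤ j → TopOf T (s a) →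
      (cCount p n T ((Finset.Icc (j + 1) k).image s) : ℝ) =
        (Fintype.card (ColoredPerm p n) : ℝ) * (fibProd n T : ℝ)⁻¹ * (gMat g d a j).det := by
  intro d
  induction d with
  | zero =>
    intro j a T hj haj ha
    have hjk : j = k := by omega
    subst hjk
    have han : s a < n := by rw [← hlast]; exact s_lt hmono (by omega) le_rfl
    have := alpha_eq hp T (s a) (fun t ht => (ha.1 t ht).trans_lt han) han.le ha
    simp only [cCount, gMat]
    simpa [hg] using this
  | succ d ih =>
    intro j a T hj haj ha
    have hE : (Finset.Icc (j + 1) k).image s =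
        insert (s (j + 1)) ((Finset.Icc (j + 1 + 1) k).image s) := by
      rw [← Finset.image_insert]
      congr 1
      ext x
      simp
      omega
    have hlt : s a < s (j + 1) := s_lt hmono (by omega) (by omega)
    rw [hE, cCount_insert _ _ _ _ _ (ha.not_mem hlt), ih (j + 1) (j + 1) _ (by omega) le_rfl
      (ha.insert hlt), ih (j + 1) a _ (by omega) (by omega) ha, gMat_det]
    · have hn' : s (j + 1) ≤ n := by rw [← hlast]; exact (s_lt hmono (by omega) le_rfl).le
      rw [fibProd_insert n T (s a) _ ha hlt hn']
      have : g a j = ((s (j + 1) - s a).factorial : ℝ)⁻¹ := by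
        rw [hg]
        simp only [invFact]
        rw [if_neg (by omega), if_pos (by omega)]
        congr 3
        omega
      rw [this]
      push_cast
      rw [mul_inv]
      ring
    · rw [hg]
      simp only [invFact]
      rw [if_neg (by omega)]
      simp
    · intro r h2 hr
      rw [hg]
      simp only [invFact]
      have := s_lt hmono (show j + 1 < j + r by omega) (by omega)
      rw [if_neg (by omega), if_neg (by omega)]
    · intro h
      simp only [Finset.mem_image, Finset.mem_Icc] at h
      obtain ⟨x, hx, hx'⟩ := h
      have := s_lt hmono (show j + 1 < x by omega) (by omega)
      omega

/-- **Corollary (uniform distribution on `G_{p,n}`, d′-descents, case `s_k < n`).**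
For `p ≥ 2` and `0 = s_0 < s_1 < ⋯ < s_k < n`, `s_{k+1} := n`, the probability that the
d′-descent set of a uniformly random `σ ∈ G_{p,n}` equals `{s_1,…,s_k}` is
`det(g′(i,j))_{i,j=0,…,k}`, with `g′(i,j) = 1/(s_{j+1}-s_i)!` for `j < k` and
`g′(i,k) = ((p-1)/p)^{n-s_i}/(n-s_i)!` (here `(p-1)/p = 1/p*`). -/
theorem statement6 (p n k : ℕ) (hp : 2 ≤ p) (hn : 1 ≤ n)
    (s : ℕ → ℕ) (hs0 : s 0 = 0) (hmono : ∀ i, i ≤ k → s i < s (i + 1))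
    (hlast : s (k + 1) = n) :
    haveI : NeZero p := ⟨by omega⟩
    ((Finset.univ.filter fun σ : ColoredPerm p n =>
        cpD'DescentSet σ = (Finset.Icc 1 k).image s).card : ℝ)
        / (Fintype.card (ColoredPerm p n) : ℝ)
      = (Matrix.of fun i j : Fin (k + 1) =>
          if (j : ℕ) = k then
            (((p : ℝ) - 1) / p) ^ (n - s (i : ℕ)) * invFact ((n : ℤ) - s (i : ℕ))
          else invFact ((s ((j : ℕ) + 1) : ℤ) - s (i : ℕ))).det := by
  haveI : NeZero p := ⟨by omega⟩
  have h := main_ind p n k hp s hmono hlast _ rfl k 0 0 ∅ (by omega) le_rfl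
    ⟨by simp, Or.inr ⟨hs0, rfl⟩⟩
  have hc : (Fintype.card (ColoredPerm p n) : ℝ) ≠ 0 := by
    exact_mod_cast Fintype.card_ne_zero
  have he : ∀ σ : ColoredPerm p n, cpD'DescentSet σ = (Finset.Icc 1 k).image s ↔
      (cpD'DescentSet σ ⊆ ∅ ∪ (Finset.Icc (0 + 1) k).image s ∧
        (Finset.Icc (0 + 1) k).image s ⊆ cpD'DescentSet σ) := by
    intro σ
    rw [Finset.empty_union, zero_add]
    exact Finset.Subset.antisymm_iff
  rw [div_eq_iff hc, mul_comm]
  simp only [he]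
  refine Eq.trans h ?_
  have hf : fibProd n ∅ = 1 := by simp [fibProd]
  rw [hf]
  simp only [Nat.cast_one, inv_one, mul_one]
  congr 2
  ext r c
  simp only [gMat, Matrix.of_apply, zero_add]
  have hr : (if (r : ℕ) = 0 then 0 else (r : ℕ)) = r := by split_ifs <;> omega
  rw [hr]
end
end
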